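/- For the bilinear map β_{μ,σ} defined in the context, one has ψ_0(β_{μ,σ}) = μ²σ^{n−2} ∫_{S^{m−1}} (u₁² + u₂²)|u₁ + u₂|^{n−2} dS_u, where u_a denotes the a-th coordinate of u ∈ S^{m−1}. -/

import Mathlib

open scoped RealInnerProductSpace BigOperators
open MeasureTheory Classical

namespace Paper

variable {V W : Type*} [NormedAddCommGroup V] [InnerProductSpace ℝ V]
  [NormedAddCommGroup W] [InnerProductSpace ℝ W]

/-- `β` is a symmetric bilinear map. -/
def IsSymmBil (β : V →ₗ[ℝ] V →ₗ[ℝ] W) : Prop := ∀ x y, β x y = β y x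

/-- The formal shape operator `A_ξ(β)`, determined by `⟪β x y, ξ⟫ = ⟪A_ξ(β) x, y⟫`. -/
noncomputable def shapeOp (β : V →ₗ[ℝ] V →ₗ[ℝ] W) (ξ : W) : V →ₗ[ℝ] V :=
  if h : ∃ A : V →ₗ[ℝ] V, ∀ x y : V, ⟪β x y, ξ⟫ = ⟪A x, y⟫ then h.choose else 0

variable {n m : ℕ}

/-- The mean curvature vector `𝓗_β = (1/n) Σ_i β(e_i, e_i)`. -/
noncomputable def meanCurv (e : OrthonormalBasis (Fin n) ℝ V)
    (β : V →ₗ[ℝ] V →ₗ[ℝ] W) : W :=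
  (n : ℝ)⁻¹ • ∑ i, β (e i) (e i)

/-- The formal Ricci tensor `Ric_c(β)`. -/
noncomputable def ric (c : ℝ) (e : OrthonormalBasis (Fin n) ℝ V)
    (β : V →ₗ[ℝ] V →ₗ[ℝ] W) (x y : V) : ℝ :=
  c * (n - 1) * ⟪x, y⟫ + n * ⟪meanCurv e β, β x y⟫
    - ∑ i, ⟪β x (e i), β y (e i)⟫

/-- The normalized scalar curvature `ρ_c(β) = (1/(n(n-1))) tr Ric_c(β)`. -/
noncomputable def rho (c : ℝ) (e : OrthonormalBasis (Fin n) ℝ V)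
    (β : V →ₗ[ℝ] V →ₗ[ℝ] W) : ℝ :=
  (n * (n - 1) : ℝ)⁻¹ * ∑ i, ric c e β (e i) (e i)

/-- The self-adjoint operator `T_c(β)` with `⟪T_c(β) x, y⟫ = (1/(n-1)) Ric_c(β)(x,y)`. -/
noncomputable def ricOp (c : ℝ) (e : OrthonormalBasis (Fin n) ℝ V)
    (β : V →ₗ[ℝ] V →ₗ[ℝ] W) : V →ₗ[ℝ] V :=
  if h : ∃ T : V →ₗ[ℝ] V, ∀ x y : V, ⟪T x, y⟫ = (n - 1 : ℝ)⁻¹ * ric c e β x y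
  then h.choose else 0

/-- The increasingly ordered eigenvalues of an endomorphism admitting an orthonormal
eigenbasis (junk value otherwise). -/
noncomputable def sortedEigs (n : ℕ) (T : V →ₗ[ℝ] V) : Fin n → ℝ :=
  if h : ∃ μ : Fin n → ℝ, Monotone μ ∧
      ∃ b : OrthonormalBasis (Fin n) ℝ V, ∀ i, T (b i) = μ i • b i
  then h.choose else fun _ => 0

/-- The `k`-th scalar curvature `ρ_{c,k}(β) = (1/k) Σ_{i=1}^k λ_{c,i}(β)`. -/
noncomputable def rhoK (c : ℝ) (k : ℕ) (e : OrthonormalBasis (Fin n) ℝ V)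
    (β : V →ₗ[ℝ] V →ₗ[ℝ] W) : ℝ :=
  (k : ℝ)⁻¹ * ∑ i ∈ Finset.univ.filter (fun i : Fin n => (i : ℕ) < k),
    sortedEigs n (ricOp c e β) i

/-- The normal scalar curvature `ρ⊥(β)`. -/
noncomputable def rhoPerp (e : OrthonormalBasis (Fin n) ℝ V)
    (ξ : OrthonormalBasis (Fin m) ℝ W) (β : V →ₗ[ℝ] V →ₗ[ℝ] W) : ℝ :=
  (n * (n - 1) : ℝ)⁻¹ * Real.sqrt (∑ a, ∑ b, ∑ i,
    ‖(shapeOp β (ξ a) ∘ₗ shapeOp β (ξ b) - shapeOp β (ξ b) ∘ₗ shapeOp β (ξ a)) (e i)‖ ^ 2)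

/-- The index of a self-adjoint endomorphism: the number of negative eigenvalues,
counted with multiplicity. -/
noncomputable def negIndex (n : ℕ) (T : V →ₗ[ℝ] V) : ℕ :=
  (Finset.univ.filter (fun i : Fin n => sortedEigs n T i < 0)).card

/-- The Hilbert–Schmidt norm `‖β‖² = Σ_{i,j} ‖β(e_i,e_j)‖²`. -/
noncomputable def normHS (e : OrthonormalBasis (Fin n) ℝ V)
    (β : V →ₗ[ℝ] V →ₗ[ℝ] W) : ℝ :=
  Real.sqrt (∑ i, ∑ j, ‖β (e i) (e j)‖ ^ 2)

/-- `ψ_p(β) = ∫_{Λ_p(β)} |det A_u(β)| dS_u` over the unit sphere of `W = ℝ^m`. -/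
noncomputable def psi (n m p : ℕ)
    (β : EuclideanSpace ℝ (Fin n) →ₗ[ℝ] EuclideanSpace ℝ (Fin n) →ₗ[ℝ]
      EuclideanSpace ℝ (Fin m)) : ℝ :=
  ∫ u in {u : Metric.sphere (0 : EuclideanSpace ℝ (Fin m)) 1 |
      p < negIndex n (shapeOp β (u : EuclideanSpace ℝ (Fin m))) ∧
      negIndex n (shapeOp β (u : EuclideanSpace ℝ (Fin m))) < n - p},
    |LinearMap.det (shapeOp β (u : EuclideanSpace ℝ (Fin m)))|
    ∂((volume : Measure (EuclideanSpace ℝ (Fin m))).toSphere)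


/-- The endomorphism `A₁` of `ℝⁿ` from the counterexample. -/
noncomputable def A1 (n : ℕ) (μ σ : ℝ) :
    EuclideanSpace ℝ (Fin n) →ₗ[ℝ] EuclideanSpace ℝ (Fin n) :=
  Matrix.toEuclideanLin (Matrix.diagonal fun i : Fin n =>
    if (i : ℕ) = 0 then μ else if (i : ℕ) = 1 then -μ else if (i : ℕ) = 2 then -σ else σ)

/-- The endomorphism `A₂` of `ℝⁿ` from the counterexample. -/
noncomputable def A2 (n : ℕ) (μ σ : ℝ) :
    EuclideanSpace ℝ (Fin n) →ₗ[ℝ] EuclideanSpace ℝ (Fin n) :=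
  Matrix.toEuclideanLin (Matrix.of fun i j : Fin n =>
    if ((i : ℕ) = 0 ∧ (j : ℕ) = 1) ∨ ((i : ℕ) = 1 ∧ (j : ℕ) = 0) then μ
    else if i = j ∧ (i : ℕ) = 2 then -σ
    else if i = j ∧ 3 ≤ (i : ℕ) then σ else 0)

/-- The symmetric bilinear map `β_{μ,σ}(x,y) = ⟨A₁x,y⟩ξ₁ + ⟨A₂x,y⟩ξ₂`. -/
noncomputable def betaMS (n m : ℕ) (hm : 2 ≤ m) (μ σ : ℝ) : EuclideanSpace ℝ (Fin n) →ₗ[ℝ] EuclideanSpace ℝ (Fin n) →ₗ[ℝ] EuclideanSpace ℝ (Fin m) :=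
  LinearMap.mk₂ ℝ
    (fun x y => ⟪A1 n μ σ x, y⟫ • (EuclideanSpace.basisFun (Fin m) ℝ ⟨0, by omega⟩)
      + ⟪A2 n μ σ x, y⟫ • (EuclideanSpace.basisFun (Fin m) ℝ ⟨1, by omega⟩))
    (by intro x x' y; simp only [map_add, inner_add_left, add_smul]; abel)
    (by intro a x y; simp only [_root_.map_smul, real_inner_smul_left, smul_add, smul_smul])
    (by intro x y y'; simp only [inner_add_right, add_smul]; abel)
    (by intro a x y; simp only [real_inner_smul_right, smul_add, smul_smul])

/-- A linear map representing `⟪β x y, ξ⟫` is the shape operator. -/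
lemma shapeOp_eq_of_inner {V W : Type*} [NormedAddCommGroup V] [InnerProductSpace ℝ V]
    [NormedAddCommGroup W] [InnerProductSpace ℝ W] {β : V →ₗ[ℝ] V →ₗ[ℝ] W} {ξ : W}
    {A : V →ₗ[ℝ] V} (hA : ∀ x y, ⟪β x y, ξ⟫ = ⟪A x, y⟫) : shapeOp β ξ = A := by
  have h : ∃ A : V →ₗ[ℝ] V, ∀ x y : V, ⟪β x y, ξ⟫ = ⟪A x, y⟫ := ⟨A, hA⟩
  rw [shapeOp, dif_pos h]
  ext x
  exact ext_inner_right ℝ fun y => by rw [← h.choose_spec, hA]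

lemma shapeOp_betaMS (n m : ℕ) (hm : 2 ≤ m) (μ σ : ℝ) (u : EuclideanSpace ℝ (Fin m)) :
    shapeOp (betaMS n m hm μ σ) u =
      u ⟨0, by omega⟩ • A1 n μ σ + u ⟨1, by omega⟩ • A2 n μ σ := by
  refine shapeOp_eq_of_inner fun x y => ?_
  simp [betaMS, inner_add_left, real_inner_smul_left, EuclideanSpace.inner_single_left]
  ring

/-- A symmetric operator has an orthonormal eigenbasis with eigenvalues `sortedEigs`. -/
lemma exists_eigenbasis_sortedEigs {n : ℕ}
    {T : EuclideanSpace ℝ (Fin n) →ₗ[ℝ] EuclideanSpace ℝ (Fin n)} (hT : T.IsSymmetric) :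
    ∃ b : OrthonormalBasis (Fin n) ℝ (EuclideanSpace ℝ (Fin n)),
      ∀ i, T (b i) = sortedEigs n T i • b i := by
  have hn : Module.finrank ℝ (EuclideanSpace ℝ (Fin n)) = n := by simp
  have h : ∃ ν : Fin n → ℝ, Monotone ν ∧
      ∃ b : OrthonormalBasis (Fin n) ℝ (EuclideanSpace ℝ (Fin n)), ∀ i, T (b i) = ν i • b i := by
    refine ⟨_, Tuple.monotone_sort (hT.eigenvalues hn),
      (hT.eigenvectorBasis hn).reindex (Tuple.sort (hT.eigenvalues hn)).symm, fun i => ?_⟩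
    simp [hT.apply_eigenvectorBasis hn]
  rw [sortedEigs, dif_pos h]
  exact h.choose_spec.2

lemma inner_apply_self_eq_sum_eigs {n : ℕ}
    {T : EuclideanSpace ℝ (Fin n) →ₗ[ℝ] EuclideanSpace ℝ (Fin n)} (hT : T.IsSymmetric)
    {b : OrthonormalBasis (Fin n) ℝ (EuclideanSpace ℝ (Fin n))} {ν : Fin n → ℝ}
    (hb : ∀ i, T (b i) = ν i • b i) (x : EuclideanSpace ℝ (Fin n)) :
    ⟪T x, x⟫ = ∑ i, ν i * ⟪b i, x⟫ ^ 2 := by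
  rw [← b.sum_inner_mul_inner (T x) x]
  refine Finset.sum_congr rfl fun i _ => ?_
  rw [hT, hb, real_inner_smul_right, real_inner_comm]
  ring

lemma negIndex_pos {n : ℕ}
    {T : EuclideanSpace ℝ (Fin n) →ₗ[ℝ] EuclideanSpace ℝ (Fin n)} (hT : T.IsSymmetric)
    {x : EuclideanSpace ℝ (Fin n)} (hx : ⟪T x, x⟫ < 0) : 0 < negIndex n T := by
  obtain ⟨b, hb⟩ := exists_eigenbasis_sortedEigs hT
  by_contra! h
  simp only [negIndex, Nat.le_zero, Finset.card_eq_zero, Finset.filter_eq_empty_iff,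
    Finset.mem_univ, true_imp_iff, not_lt] at h
  rw [inner_apply_self_eq_sum_eigs hT hb] at hx
  exact hx.not_ge (Finset.sum_nonneg fun i _ => mul_nonneg (h (x := i)) (sq_nonneg _))

lemma negIndex_lt {n : ℕ}
    {T : EuclideanSpace ℝ (Fin n) →ₗ[ℝ] EuclideanSpace ℝ (Fin n)} (hT : T.IsSymmetric)
    {x : EuclideanSpace ℝ (Fin n)} (hx : 0 < ⟪T x, x⟫) : negIndex n T < n := by
  obtain ⟨b, hb⟩ := exists_eigenbasis_sortedEigs hT
  rw [inner_apply_self_eq_sum_eigs hT hb] at hx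
  obtain ⟨i, -, hi⟩ := Finset.exists_lt_of_sum_lt (f := fun _ => (0 : ℝ)) (by simpa using hx)
  have h : negIndex n T < (Finset.univ : Finset (Fin n)).card := by
    refine Finset.card_lt_card (Finset.filter_ssubset.2 ⟨i, Finset.mem_univ i, fun hneg => ?_⟩)
    exact hi.not_ge (mul_nonpos_of_nonpos_of_nonneg hneg.le (sq_nonneg _))
  simpa using h

/-- The matrix of `s A₁ + t A₂` in the standard basis. -/
noncomputable def pencil (n : ℕ) (μ σ s t : ℝ) : Matrix (Fin n) (Fin n) ℝ :=
  Matrix.of fun i j =>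
    if (i : ℕ) = 0 ∧ (j : ℕ) = 0 then μ * s
    else if (i : ℕ) = 1 ∧ (j : ℕ) = 1 then -(μ * s)
    else if ((i : ℕ) = 0 ∧ (j : ℕ) = 1) ∨ ((i : ℕ) = 1 ∧ (j : ℕ) = 0) then μ * t
    else if i = j then (if (i : ℕ) = 2 then -σ else σ) * (s + t) else 0

lemma smul_A1_add_smul_A2 (n : ℕ) (μ σ s t : ℝ) :
    s • A1 n μ σ + t • A2 n μ σ = Matrix.toEuclideanLin (pencil n μ σ s t) := by
  rw [A1, A2, ← map_smul, ← map_smul, ← map_add]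
  congr 1
  ext i j
  simp only [Matrix.add_apply, Matrix.smul_apply, Matrix.diagonal_apply, Matrix.of_apply, pencil,
    smul_eq_mul, Fin.ext_iff]
  split_ifs <;> first | omega | ring

lemma pencil_isSymm (n : ℕ) (μ σ s t : ℝ) : (pencil n μ σ s t).IsSymm := by
  ext i j
  simp only [Matrix.transpose_apply, pencil, Matrix.of_apply, Fin.ext_iff]
  split_ifs <;> first | omega | rfl

lemma pencil_mul_self (k : ℕ) (μ σ s t : ℝ) :
    pencil (k + 2) μ σ s t * pencil (k + 2) μ σ s t =
      Matrix.diagonal fun i : Fin (k + 2) =>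
        if (i : ℕ) < 2 then μ ^ 2 * (s ^ 2 + t ^ 2) else σ ^ 2 * (s + t) ^ 2 := by
  ext i j
  rw [Matrix.mul_apply, Fin.sum_univ_succ, Fin.sum_univ_succ]
  refine Fin.cases ?_ (Fin.cases ?_ fun i => ?_) i <;>
  refine Fin.cases ?_ (Fin.cases ?_ fun j => ?_) j <;>
  simp only [pencil, Matrix.of_apply, Matrix.diagonal_apply, Fin.ext_iff, Fin.val_zero,
    Fin.val_succ] <;> simp
  any_goals ring1
  rw [Finset.sum_eq_single i (fun x _ hx => by simp [Fin.val_inj, hx.symm]) (by simp)]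
  split_ifs <;> first | ring1 | omega

lemma abs_det_pencil (k : ℕ) {μ σ : ℝ} (hσ : 0 < σ) (s t : ℝ) :
    |(pencil (k + 2) μ σ s t).det| = μ ^ 2 * (s ^ 2 + t ^ 2) * (σ * |s + t|) ^ k := by
  rw [← abs_of_nonneg (a := μ ^ 2 * (s ^ 2 + t ^ 2) * (σ * |s + t|) ^ k) (by positivity),
    ← sq_eq_sq_iff_abs_eq_abs, sq, ← Matrix.det_mul, pencil_mul_self, Matrix.det_diagonal,
    Fin.prod_univ_succ, Fin.prod_univ_succ]
  simp [mul_pow]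
  rw [← sq_abs (s + t)]
  ring

lemma index_pencil (k : ℕ) {μ : ℝ} (hμ : 0 < μ) (σ s t : ℝ) (hst : s ^ 2 + t ^ 2 ≠ 0) :
    0 < negIndex (k + 2) (Matrix.toEuclideanLin (pencil (k + 2) μ σ s t)) ∧
      negIndex (k + 2) (Matrix.toEuclideanLin (pencil (k + 2) μ σ s t)) < k + 2 := by
  set T := Matrix.toEuclideanLin (pencil (k + 2) μ σ s t) with hTdef
  have hT : T.IsSymmetric := by
    rw [hTdef, Matrix.isSymmetric_toEuclideanLin_iff]
    exact (Matrix.conjTranspose_eq_transpose_of_trivial _).trans (pencil_isSymm (k + 2) μ σ s t)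
  have hQ (a b : ℝ) : ⟪T (a • EuclideanSpace.single 0 (1 : ℝ) + b • EuclideanSpace.single 1 (1 : ℝ)),
      a • EuclideanSpace.single 0 (1 : ℝ) + b • EuclideanSpace.single 1 (1 : ℝ)⟫ =
        μ * (s * (a ^ 2 - b ^ 2) + 2 * t * (a * b)) := by
    simp only [T, inner_add_right, real_inner_smul_right, EuclideanSpace.inner_single_right,
      Matrix.toLpLin_apply, WithLp.ofLp_add, WithLp.ofLp_smul, PiLp.ofLp_single,
      Matrix.mulVec_add, Matrix.mulVec_smul, Matrix.mulVec_single_one]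
    simp [pencil]
    ring
  obtain ⟨a, b, hab⟩ : ∃ a b : ℝ, 0 < s * (a ^ 2 - b ^ 2) + 2 * t * (a * b) := by
    by_contra! h
    have hs : s = 0 := by linarith [h 1 0, h 0 1]
    have ht : t = 0 := by linarith [h 1 1, h 1 (-1)]
    simp [hs, ht] at hst
  constructor
  · refine negIndex_pos hT (x := (-b) • EuclideanSpace.single 0 1 + a • EuclideanSpace.single 1 1) ?_
    rw [hQ]
    nlinarith
  · refine negIndex_lt hT (x := a • EuclideanSpace.single 0 1 + b • EuclideanSpace.single 1 1) ?_
    rw [hQ]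
    exact mul_pos hμ hab

theorem stmt17 (n m : ℕ) (hn : 3 ≤ n) (hm : 2 ≤ m)
    (μ σ : ℝ) (hμ : 0 < μ) (hσ : 0 < σ) :
    psi n m 0 (betaMS n m hm μ σ) =
      μ ^ 2 * σ ^ (n - 2) *
        ∫ u : Metric.sphere (0 : EuclideanSpace ℝ (Fin m)) 1,
          (((u : EuclideanSpace ℝ (Fin m)) ⟨0, by omega⟩) ^ 2
              + ((u : EuclideanSpace ℝ (Fin m)) ⟨1, by omega⟩) ^ 2)
            * |(u : EuclideanSpace ℝ (Fin m)) ⟨0, by omega⟩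
                + (u : EuclideanSpace ℝ (Fin m)) ⟨1, by omega⟩| ^ (n - 2)
          ∂((volume : Measure (EuclideanSpace ℝ (Fin m))).toSphere) := by
  obtain ⟨k, rfl⟩ : ∃ k, n = k + 2 := ⟨n - 2, by omega⟩
  have hdet (s t : ℝ) : |LinearMap.det (Matrix.toEuclideanLin (pencil (k + 2) μ σ s t))| =
      μ ^ 2 * (s ^ 2 + t ^ 2) * (σ * |s + t|) ^ k := by
    rw [Matrix.toEuclideanLin, Matrix.toLpLin_eq_toLin, LinearMap.det_toLin, abs_det_pencil k hσ]
  simp only [psi, shapeOp_betaMS, smul_A1_add_smul_A2, hdet, Nat.sub_zero]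
  rw [setIntegral_eq_integral_of_forall_compl_eq_zero, ← integral_const_mul]
  · refine integral_congr_ae (.of_forall fun u => ?_)
    simp only [Nat.add_sub_cancel, mul_pow]
    ring
  · intro u hu
    by_contra h
    refine hu (index_pencil k hμ σ _ _ fun h0 => h ?_)
    rw [h0]
    ring

end Paper
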